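/- arXiv:2507.12626 — 2 statements merged into one kernel-verified Lean document; each statement's English description precedes it below -/
import Mathlib

section
/- A circuit (n,m,f) is feasible with k auxiliaries if and only if there exists a function g : Σ^n → Σ^k such that the circuit (n, m+k, f×g) is feasible, where (f×g)(x) = (f(x), g(x)). -/
open Finset

def IsSpin {d : ℕ} (s : Fin d → ℝ) : Prop := ∀ i, s i = -1 ∨ s i = 1

def StrictUpper {d : ℕ} (J : Matrix (Fin d) (Fin d) ℝ) : Prop :=
  ∀ i j : Fin d, ¬ i < j → J i j = 0

noncomputable def isingH {d : ℕ} (h : Fin d → ℝ) (J : Matrix (Fin d) (Fin d) ℝ)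
    (s : Fin d → ℝ) : ℝ :=
  (∑ i, h i * s i) + ∑ i, ∑ j, if i < j then J i j * s i * s j else 0

def Encodes {n m : ℕ} (H : (Fin (n + m) → ℝ) → ℝ)
    (f : (Fin n → ℝ) → (Fin m → ℝ)) : Prop :=
  ∀ x, IsSpin x → ∀ y, IsSpin y → y ≠ f x →
    H (Fin.append x (f x)) < H (Fin.append x y)

def Feasible (n m : ℕ) (f : (Fin n → ℝ) → (Fin m → ℝ)) : Prop :=
  ∃ (h : Fin (n + m) → ℝ) (J : Matrix (Fin (n + m)) (Fin (n + m)) ℝ),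
    StrictUpper J ∧ Encodes (isingH h J) f

/-- The circuit `(n,m,f)` is feasible with `k` auxiliaries: there is an Ising Hamiltonian
on `n + (m + k)` spins such that for every spin input `x`, every minimizer `(y,z)` of
`(y,z) ↦ H(x,y,z)` over spin states satisfies `y = f x`. -/
def FeasibleWithAux (n m k : ℕ) (f : (Fin n → ℝ) → (Fin m → ℝ)) : Prop :=
  ∃ (h : Fin (n + (m + k)) → ℝ)
    (J : Matrix (Fin (n + (m + k))) (Fin (n + (m + k))) ℝ),
    StrictUpper J ∧
    ∀ x, IsSpin x → ∀ (y : Fin m → ℝ) (z : Fin k → ℝ), IsSpin y → IsSpin z →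
      (∀ (y' : Fin m → ℝ) (z' : Fin k → ℝ), IsSpin y' → IsSpin z' →
        isingH h J (Fin.append x (Fin.append y z)) ≤
          isingH h J (Fin.append x (Fin.append y' z'))) →
      y = f x

theorem isSpin_append {a b : ℕ} {x : Fin a → ℝ} {y : Fin b → ℝ} (hx : IsSpin x)
    (hy : IsSpin y) : IsSpin (Fin.append x y) := by
  intro i
  refine Fin.addCases (fun i => ?_) (fun i => ?_) i
  · simpa using hx i
  · simpa using hy i

theorem finite_setOf_isSpin (d : ℕ) : {s : Fin d → ℝ | IsSpin s}.Finite := by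
  have h : {s : Fin d → ℝ | IsSpin s} = Set.univ.pi fun _ => ({-1, 1} : Set ℝ) := by
    ext s
    simp [IsSpin, Set.mem_pi]
  rw [h]
  exact Set.Finite.pi fun _ => Set.toFinite _

/-- The linear functional with weights `3⁻ⁱ`, which separates spin states. -/
noncomputable def ternarySum {d : ℕ} (s : Fin d → ℝ) : ℝ :=
  ∑ i : Fin d, (1 / 3 : ℝ) ^ (i : ℕ) * s i

theorem ternarySum_succ {d : ℕ} (s : Fin (d + 1) → ℝ) :
    ternarySum s = s 0 + 1 / 3 * ternarySum (fun i => s i.succ) := by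
  simp only [ternarySum, Fin.sum_univ_succ, Finset.mul_sum, Fin.val_zero, pow_zero, one_mul,
    Fin.val_succ, pow_succ']
  simp only [mul_assoc]

theorem abs_ternarySum_le {d : ℕ} {s : Fin d → ℝ} (hs : IsSpin s) :
    |ternarySum s| ≤ 3 / 2 := by
  induction d with
  | zero => norm_num [ternarySum]
  | succ d ih =>
    have h := abs_le.mp (ih (s := fun i => s i.succ) fun i => hs i.succ)
    rw [ternarySum_succ, abs_le]
    rcases hs 0 with h0 | h0 <;> rw [h0] <;> constructor <;> linarith [h.1, h.2]

theorem ternarySum_injOn (d : ℕ) :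
    Set.InjOn (ternarySum (d := d)) {s | IsSpin s} := by
  induction d with
  | zero => exact fun s _ t _ _ => Subsingleton.elim s t
  | succ d ih =>
    intro s hs t ht hst
    have hs' : IsSpin fun i : Fin d => s i.succ := fun i => hs i.succ
    have ht' : IsSpin fun i : Fin d => t i.succ := fun i => ht i.succ
    have bs := abs_le.mp (abs_ternarySum_le hs')
    have bt := abs_le.mp (abs_ternarySum_le ht')
    rw [ternarySum_succ, ternarySum_succ] at hst
    have h0 : s 0 = t 0 := by
      rcases hs 0 with h | h <;> rcases ht 0 with h' | h' <;> rw [h, h'] at hst ⊢ <;>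
        linarith [bs.1, bs.2, bt.1, bt.2]
    have htail := ih hs' ht' (by linarith)
    funext i
    refine Fin.cases h0 (fun j => congrFun htail j) i

/-- On a finite set, a sufficiently small perturbation preserves strict inequalities. -/
theorem exists_pos_perturbation {α : Type*} {S : Set α} (hS : S.Finite) (F L : α → ℝ) :
    ∃ ε > 0, ∀ a ∈ S, ∀ b ∈ S, F a < F b → F a + ε * L a < F b + ε * L b := by
  have h : ∀ᶠ ε in nhdsWithin (0 : ℝ) (Set.Ioi 0),
      ∀ a ∈ S, ∀ b ∈ S, F a < F b → F a + ε * L a < F b + ε * L b := by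
    refine nhdsWithin_le_nhds ?_
    refine (Filter.eventually_all_finite hS).2 fun a _ =>
      (Filter.eventually_all_finite hS).2 fun b _ => ?_
    by_cases hab : F a < F b
    · have ha : Continuous fun ε : ℝ => F a + ε * L a := by fun_prop
      have hb : Continuous fun ε : ℝ => F b + ε * L b := by fun_prop
      filter_upwards [ha.continuousAt.eventually_lt hb.continuousAt
        (by simpa using hab : F a + 0 * L a < F b + 0 * L b)] with ε hε _ using hε
    · exact Filter.Eventually.of_forall fun _ h => absurd h hab
  obtain ⟨ε, hε, hpos⟩ := (h.and self_mem_nhdsWithin).exists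
  exact ⟨ε, hpos, hε⟩

/-- Adding weights `ε 3⁻ʲ` to the fields of the last `m` spins. -/
theorem isingH_add_ternary {n m : ℕ} (h : Fin (n + m) → ℝ)
    (J : Matrix (Fin (n + m)) (Fin (n + m)) ℝ) (ε : ℝ) (s : Fin (n + m) → ℝ) :
    isingH (fun i => h i + ε * Fin.append (fun _ : Fin n => (0 : ℝ))
        (fun j : Fin m => (1 / 3 : ℝ) ^ (j : ℕ)) i) J s =
      isingH h J s + ε * ternarySum (fun j => s (Fin.natAdd n j)) := by
  simp only [isingH, ternarySum, add_mul, Finset.sum_add_distrib, mul_assoc, ← Finset.mul_sum]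
  rw [Fin.sum_univ_add (fun i => Fin.append (fun _ : Fin n => (0 : ℝ))
        (fun j : Fin m => (1 / 3 : ℝ) ^ (j : ℕ)) i * s i)]
  simp only [Fin.append_left, Fin.append_right, zero_mul, Finset.sum_const_zero, zero_add]
  ring

/-- Every Ising Hamiltonian has a perturbation with a unique output minimizer for each input,
which is also a minimizer of the original Hamiltonian. -/
theorem exists_encodes_minimizer {n m : ℕ} (h : Fin (n + m) → ℝ)
    (J : Matrix (Fin (n + m)) (Fin (n + m)) ℝ) :
    ∃ (h' : Fin (n + m) → ℝ) (w : (Fin n → ℝ) → (Fin m → ℝ)),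
      Encodes (isingH h' J) w ∧ ∀ x, IsSpin x → IsSpin (w x) ∧
        ∀ y, IsSpin y → isingH h J (Fin.append x (w x)) ≤ isingH h J (Fin.append x y) := by
  obtain ⟨ε, hε, hlt⟩ := exists_pos_perturbation (finite_setOf_isSpin (n + m)) (isingH h J)
    (fun s => ternarySum (fun j => s (Fin.natAdd n j)))
  simp only [← isingH_add_ternary] at hlt
  set h' : Fin (n + m) → ℝ := fun i => h i + ε * Fin.append (fun _ : Fin n => (0 : ℝ))
    (fun j : Fin m => (1 / 3 : ℝ) ^ (j : ℕ)) i with hh'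
  have hmin : ∀ x : Fin n → ℝ, ∃ w : Fin m → ℝ, IsSpin w ∧ ∀ y, IsSpin y →
      isingH h' J (Fin.append x w) ≤ isingH h' J (Fin.append x y) := fun x =>
    Set.exists_min_image {s | IsSpin s} (fun w => isingH h' J (Fin.append x w))
      (finite_setOf_isSpin m) ⟨fun _ => 1, fun _ => Or.inr rfl⟩
  have hdesc : ∀ x, IsSpin x → ∀ w, IsSpin w →
      (∀ y, IsSpin y → isingH h' J (Fin.append x w) ≤ isingH h' J (Fin.append x y)) →
      ∀ y, IsSpin y → isingH h J (Fin.append x w) ≤ isingH h J (Fin.append x y) := by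
    intro x hx w hw hwmin y hy
    by_contra! hyw
    exact (hwmin y hy).not_gt (hlt _ (isSpin_append hx hy) _ (isSpin_append hx hw) hyw)
  choose w hw hwmin using hmin
  refine ⟨h', w, ?_, fun x hx => ⟨hw x, hdesc x hx _ (hw x) (hwmin x)⟩⟩
  intro x hx y hy hne
  refine (hwmin x y hy).lt_of_ne fun heq => hne ?_
  have hymin : ∀ y', IsSpin y' →
      isingH h' J (Fin.append x y) ≤ isingH h' J (Fin.append x y') :=
    fun y' hy' => heq ▸ hwmin x y' hy'
  have hH := le_antisymm (hdesc x hx y hy hymin _ (hw x)) (hdesc x hx _ (hw x) (hwmin x) y hy)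
  rw [hh', isingH_add_ternary, isingH_add_ternary, hH] at heq
  simp only [Fin.append_right] at heq
  exact (ternarySum_injOn m (hw x) hy (mul_left_cancel₀ hε.ne' (add_left_cancel heq))).symm

/-- `(n,m,f)` is feasible with `k` auxiliaries iff there is an auxiliary map
`g : Σⁿ → Σᵏ` such that `(n, m+k, f × g)` is feasible. -/
theorem statement3 (n m k : ℕ) (f : (Fin n → ℝ) → (Fin m → ℝ))
    (hf : ∀ x, IsSpin x → IsSpin (f x)) :
    FeasibleWithAux n m k f ↔
      ∃ g : (Fin n → ℝ) → (Fin k → ℝ), (∀ x, IsSpin x → IsSpin (g x)) ∧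
        Feasible n (m + k) (fun x => Fin.append (f x) (g x)) := by
  constructor
  · rintro ⟨h, J, hJ, hmin⟩
    obtain ⟨h', w, henc, hw⟩ := exists_encodes_minimizer h J
    have hsplit : ∀ x, Fin.append (fun i => w x (Fin.castAdd k i))
        (fun j => w x (Fin.natAdd m j)) = w x := fun x => Fin.append_castAdd_natAdd
    have hfw : ∀ x, IsSpin x → (fun i => w x (Fin.castAdd k i)) = f x := by
      intro x hx
      refine hmin x hx _ (fun j => w x (Fin.natAdd m j)) (fun i => (hw x hx).1 _)
        (fun j => (hw x hx).1 _) fun y' z' hy' hz' => ?_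
      rw [hsplit]
      exact (hw x hx).2 _ (isSpin_append hy' hz')
    refine ⟨fun x j => w x (Fin.natAdd m j), fun x hx j => (hw x hx).1 _, h', J, hJ, ?_⟩
    intro x hx y hy hne
    simp only [← hfw x hx, hsplit] at hne ⊢
    exact henc x hx y hy hne
  · rintro ⟨g, hg, h, J, hJ, henc⟩
    refine ⟨h, J, hJ, fun x hx y z hy hz hmin => ?_⟩
    by_contra hne
    refine (hmin (f x) (g x) (hf x hx) (hg x hx)).not_gt
      (henc x hx _ (isSpin_append hy hz) fun heq => hne ?_)
    funext i
    simpa using congrFun heq (Fin.castAdd k i)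
end

section
/- A circuit (2,m,f) with components f = f₁×⋯×f_m is feasible if and only if at least one of the following holds: (1) no component f_i is XOR or −XOR, i.e., no f_i satisfies f_i(x₁,x₂) = −x₁x₂ for all x or f_i(x₁,x₂) = x₁x₂ for all x; or (2) at least one component f_i is AND up to spin action, i.e., there exist signs σ₀, σ₁, σ₂ ∈ Σ with f_i(x₁,x₂) = σ₀·AND(σ₁x₁, σ₂x₂) for all (x₁,x₂) ∈ Σ². -/
open Finset

/-- Spin-convention AND: `1` if both arguments are `1`, else `-1`. -/
noncomputable def spinAND (a b : ℝ) : ℝ := if a = 1 ∧ b = 1 then 1 else -1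

/-- The four inputs of a two-spin circuit. -/
noncomputable def spinPoint : Fin 4 → Fin 2 → ℝ :=
  ![![1, 1], ![1, -1], ![-1, 1], ![-1, -1]]

lemma isSpin_spinPoint (p : Fin 4) : IsSpin (spinPoint p) := by
  intro i
  fin_cases p <;> fin_cases i <;> simp [spinPoint]

lemma IsSpin.exists_spinPoint {x : Fin 2 → ℝ} (hx : IsSpin x) : ∃ p, x = spinPoint p := by
  have hx' : x = ![x 0, x 1] := by
    ext i
    fin_cases i <;> rfl
  rcases hx 0 with h0 | h0 <;> rcases hx 1 with h1 | h1 <;> rw [hx', h0, h1]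
  exacts [⟨3, rfl⟩, ⟨2, rfl⟩, ⟨1, rfl⟩, ⟨0, rfl⟩]

lemma forall_isSpin_two {P : (Fin 2 → ℝ) → Prop} :
    (∀ x, IsSpin x → P x) ↔
      P ![1, 1] ∧ P ![1, -1] ∧ P ![-1, 1] ∧ P ![-1, -1] := by
  constructor
  · intro h
    exact ⟨h _ (isSpin_spinPoint 0), h _ (isSpin_spinPoint 1), h _ (isSpin_spinPoint 2),
      h _ (isSpin_spinPoint 3)⟩
  · rintro ⟨h0, h1, h2, h3⟩ x hx
    obtain ⟨p, rfl⟩ := hx.exists_spinPoint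
    fin_cases p
    exacts [h0, h1, h2, h3]

/-- A function of a spin configuration which is an Ising Hamiltonian. -/
def IsIsing {d : ℕ} (H : (Fin d → ℝ) → ℝ) : Prop :=
  ∃ (h : Fin d → ℝ) (J : Matrix (Fin d) (Fin d) ℝ), StrictUpper J ∧ ∀ s, isingH h J s = H s

namespace IsIsing

variable {d : ℕ} {H K : (Fin d → ℝ) → ℝ}

lemma zero : IsIsing (fun _ : Fin d → ℝ => 0) :=
  ⟨0, 0, fun _ _ _ => rfl, fun s => by simp [isingH]⟩

lemma add (hH : IsIsing H) (hK : IsIsing K) : IsIsing (fun s => H s + K s) := by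
  obtain ⟨h, J, hJ, e⟩ := hH
  obtain ⟨h', J', hJ', e'⟩ := hK
  refine ⟨h + h', J + J', fun i j hij => by simp [hJ i j hij, hJ' i j hij], fun s => ?_⟩
  beta_reduce
  rw [← e, ← e']
  simp only [isingH, Pi.add_apply, Matrix.add_apply, add_mul]
  have : ∀ i j : Fin d, (if i < j then J i j * s i * s j + J' i j * s i * s j else 0) =
      (if i < j then J i j * s i * s j else 0) + if i < j then J' i j * s i * s j else 0 := by
    intro i j
    split_ifs <;> simp
  simp only [this, sum_add_distrib]
  ring

lemma const_mul (c : ℝ) (hH : IsIsing H) : IsIsing (fun s => c * H s) := by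
  obtain ⟨h, J, hJ, e⟩ := hH
  refine ⟨c • h, c • J, fun i j hij => by simp [hJ i j hij], fun s => ?_⟩
  beta_reduce
  rw [← e]
  simp only [isingH, Pi.smul_apply, Matrix.smul_apply, smul_eq_mul, mul_add, mul_sum, mul_ite,
    mul_zero, mul_assoc]

lemma sum {ι : Type*} (t : Finset ι) {F : ι → (Fin d → ℝ) → ℝ} (hF : ∀ i ∈ t, IsIsing (F i)) :
    IsIsing (fun s => ∑ i ∈ t, F i s) := by
  classical
  induction t using Finset.induction_on with
  | empty => simpa using zero
  | insert a t ha ih =>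
    simp only [sum_insert ha]
    exact (hF a (mem_insert_self a t)).add (ih fun i hi => hF i (mem_insert_of_mem hi))

lemma apply (i : Fin d) : IsIsing (fun s => s i) :=
  ⟨Pi.single i 1, 0, fun _ _ _ => rfl, fun s => by simp [isingH, Pi.single_apply]⟩

lemma apply_mul_apply_of_lt {i j : Fin d} (hij : i < j) : IsIsing (fun s => s i * s j) := by
  refine ⟨0, fun a b => if a = i ∧ b = j then 1 else 0, ?_, fun s => ?_⟩
  · intro a b hab
    refine if_neg ?_
    rintro ⟨rfl, rfl⟩
    exact hab hij
  · simp only [isingH, Pi.zero_apply, zero_mul, sum_const_zero, zero_add]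
    rw [sum_eq_single i, sum_eq_single j]
    · simp [hij]
    · intro b _ hb
      simp [hb]
    · simp
    · intro a _ ha
      simp [ha]
    · simp

lemma apply_mul_apply {i j : Fin d} (hij : i ≠ j) : IsIsing (fun s => s i * s j) := by
  rcases lt_or_gt_of_ne hij with h | h
  · exact apply_mul_apply_of_lt h
  · simpa only [mul_comm] using apply_mul_apply_of_lt h

end IsIsing

/-- A circuit is feasible as soon as its outputs uniquely maximize a quadratic form in which every
output spin is coupled to an affine function of the inputs and to the other output spins. -/
lemma feasible_of_forall_lt {m : ℕ} {f : (Fin 2 → ℝ) → Fin m → ℝ}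
    (a b c : Fin m → ℝ) (D : Fin m → Fin m → ℝ) (hD : ∀ i, D i i = 0)
    (hlt : ∀ x, IsSpin x → ∀ y, IsSpin y → y ≠ f x →
      ∑ i, y i * (a i + b i * x 0 + c i * x 1 + ∑ j, D i j * y j) <
        ∑ i, f x i * (a i + b i * x 0 + c i * x 1 + ∑ j, D i j * f x j)) :
    Feasible 2 m f := by
  have hI : IsIsing (fun s : Fin (2 + m) → ℝ => (-1) * ∑ i : Fin m,
      (a i * s (Fin.natAdd 2 i) + b i * (s (Fin.castAdd m 0) * s (Fin.natAdd 2 i)) +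
        c i * (s (Fin.castAdd m 1) * s (Fin.natAdd 2 i)) +
        ∑ j, D i j * (s (Fin.natAdd 2 i) * s (Fin.natAdd 2 j)))) := by
    have hne : ∀ (p : Fin 2) (i : Fin m), Fin.castAdd m p ≠ Fin.natAdd 2 i := by
      intro p i h
      have := congrArg Fin.val h
      simp only [Fin.val_castAdd, Fin.val_natAdd] at this
      omega
    refine IsIsing.const_mul _ (IsIsing.sum _ fun i _ => ?_)
    refine (((IsIsing.apply _).const_mul _).add
      ((IsIsing.apply_mul_apply (hne 0 i)).const_mul _)).add
      ((IsIsing.apply_mul_apply (hne 1 i)).const_mul _) |>.add (IsIsing.sum _ fun j _ => ?_)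
    rcases eq_or_ne i j with rfl | hij
    · simpa [hD] using IsIsing.zero
    · exact (IsIsing.apply_mul_apply (by simpa using hij)).const_mul _
  obtain ⟨h, J, hJ, e⟩ := hI
  have e' : ∀ x y, isingH h J (Fin.append x y) =
      -∑ i, y i * (a i + b i * x 0 + c i * x 1 + ∑ j, D i j * y j) := by
    intro x y
    rw [e]
    beta_reduce
    rw [neg_one_mul]
    simp only [Fin.append_left, Fin.append_right, mul_add, mul_sum]
    refine congrArg Neg.neg (sum_congr rfl fun i _ => ?_)
    refine congrArg₂ _ ?_ ?_
    · ring
    · exact sum_congr rfl fun j _ => by ring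
  refine ⟨h, J, hJ, fun x hx y hy hne => ?_⟩
  rw [e', e']
  exact neg_lt_neg (hlt x hx y hy hne)

/-- Four times the Walsh coefficient of `x 0 * x 1` in a function of two spins. -/
noncomputable def walshTop (g : (Fin 2 → ℝ) → ℝ) : ℝ :=
  g ![1, 1] - g ![1, -1] - g ![-1, 1] + g ![-1, -1]

/-- Removing the `x 0 * x 1` term from a function of two spins leaves an affine function. -/
lemma exists_walsh_expansion (g : (Fin 2 → ℝ) → ℝ) :
    ∃ a b c : ℝ, ∀ x, IsSpin x →
      a + b * x 0 + c * x 1 = 4 * g x - walshTop g * (x 0 * x 1) := by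
  refine ⟨g ![1, 1] + g ![1, -1] + g ![-1, 1] + g ![-1, -1],
    g ![1, 1] + g ![1, -1] - g ![-1, 1] - g ![-1, -1],
    g ![1, 1] - g ![1, -1] + g ![-1, 1] - g ![-1, -1], ?_⟩
  rw [forall_isSpin_two]
  refine ⟨?_, ?_, ?_, ?_⟩ <;> simp [walshTop] <;> ring

lemma abs_walshTop_le_two {g : (Fin 2 → ℝ) → ℝ} (hg : ∀ x, IsSpin x → g x = -1 ∨ g x = 1)
    (h₁ : ¬ ∀ x, IsSpin x → g x = -(x 0 * x 1)) (h₂ : ¬ ∀ x, IsSpin x → g x = x 0 * x 1) :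
    |walshTop g| ≤ 2 := by
  rw [forall_isSpin_two] at hg h₁ h₂
  obtain ⟨hp, hq, hr, ht⟩ := hg
  rw [abs_le]
  rcases hp with hp | hp <;> rcases hq with hq | hq <;> rcases hr with hr | hr <;>
    rcases ht with ht | ht <;> simp [hp, hq, hr, ht] at h₁ h₂ <;>
    simp only [walshTop, hp, hq, hr, ht] <;> norm_num

lemma spin_sq {a : ℝ} (ha : a = -1 ∨ a = 1) : a * a = 1 := by
  rcases ha with rfl | rfl <;> norm_num

/-- A two-spin Boolean function other than `±XOR` is a linear threshold function. -/
lemma exists_threshold {g : (Fin 2 → ℝ) → ℝ} (hg : ∀ x, IsSpin x → g x = -1 ∨ g x = 1)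
    (hw : |walshTop g| ≤ 2) :
    ∃ a b c : ℝ, ∀ x, IsSpin x → 1 ≤ g x * (a + b * x 0 + c * x 1) := by
  obtain ⟨a, b, c, h⟩ := exists_walsh_expansion g
  refine ⟨a, b, c, fun x hx => ?_⟩
  rw [h x hx]
  rw [abs_le] at hw
  rcases hg x hx with h | h <;> rcases hx 0 with h0 | h0 <;> rcases hx 1 with h1 | h1 <;>
    rw [h, h0, h1] <;> linarith

lemma spin_mul_le {y g L : ℝ} (hy : y = -1 ∨ y = 1) (hg : g = -1 ∨ g = 1) (h : 0 < g * L) :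
    y * L ≤ g * L := by
  rcases hy with rfl | rfl <;> rcases hg with rfl | rfl <;> linarith

lemma spin_mul_lt {y g L : ℝ} (hy : y = -1 ∨ y = 1) (hg : g = -1 ∨ g = 1) (h : 0 < g * L)
    (hne : y ≠ g) : y * L < g * L := by
  rcases hy with rfl | rfl <;> rcases hg with rfl | rfl <;> first | linarith | exact absurd rfl hne

/-- If `L` is a field aligned with the spin configuration `g`, then `g` uniquely maximizes the
overlap with `L`. -/
lemma sum_spin_mul_lt {ι : Type*} {t : Finset ι} {y g L : ι → ℝ}
    (hy : ∀ i ∈ t, y i = -1 ∨ y i = 1)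
    (hg : ∀ i ∈ t, g i = -1 ∨ g i = 1) (h : ∀ i ∈ t, 0 < g i * L i) (hne : ∃ i ∈ t, y i ≠ g i) :
    ∑ i ∈ t, y i * L i < ∑ i ∈ t, g i * L i := by
  obtain ⟨k, hk, hne⟩ := hne
  exact sum_lt_sum (fun i hi => spin_mul_le (hy i hi) (hg i hi) (h i hi))
    ⟨k, hk, spin_mul_lt (hy k hk) (hg k hk) (h k hk) hne⟩

lemma feasible_of_forall_abs_walshTop_le {m : ℕ} {f : (Fin 2 → ℝ) → Fin m → ℝ}
    (hf : ∀ x, IsSpin x → IsSpin (f x)) (hw : ∀ i, |walshTop (fun x => f x i)| ≤ 2) :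
    Feasible 2 m f := by
  choose a b c h using fun i => exists_threshold (fun x hx => hf x hx i) (hw i)
  refine feasible_of_forall_lt a b c 0 (fun _ => rfl) fun x hx y hy hne => ?_
  simp only [Pi.zero_apply, zero_mul, sum_const_zero, add_zero]
  obtain ⟨k, hk⟩ := Function.ne_iff.mp hne
  exact sum_spin_mul_lt (fun i _ => hy i) (fun i _ => hf x hx i)
    (fun i _ => zero_lt_one.trans_le (h i x hx)) ⟨k, mem_univ k, hk⟩

/-- A component which is a threshold function with a nonzero `XOR` coefficient can serve as an
auxiliary spin from which all other components are computed linearly. -/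
lemma feasible_of_walshTop_ne_zero {m : ℕ} {f : (Fin 2 → ℝ) → Fin m → ℝ}
    (hf : ∀ x, IsSpin x → IsSpin (f x)) (k : Fin m) (hk : walshTop (fun x => f x k) ≠ 0)
    (hw : |walshTop (fun x => f x k)| ≤ 2) :
    Feasible 2 m f := by
  have hlin : ∀ i, ∃ a b c e : ℝ, ∀ x, IsSpin x → a + b * x 0 + c * x 1 + e * f x k = f x i := by
    intro i
    obtain ⟨a, b, c, h⟩ := exists_walsh_expansion (fun x => f x i)
    obtain ⟨a', b', c', h'⟩ := exists_walsh_expansion (fun x => f x k)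
    set w := walshTop (fun x => f x k)
    set v := walshTop (fun x => f x i)
    refine ⟨(a - v / w * a') / 4, (b - v / w * b') / 4, (c - v / w * c') / 4, v / w,
      fun x hx => ?_⟩
    have hvw : v / w * w = v := div_mul_cancel₀ v hk
    linear_combination (h x hx) / 4 - v / w * (h' x hx) / 4 + x 0 * x 1 / 4 * hvw
  choose a b c e hlin using hlin
  obtain ⟨a', b', c', hthr⟩ := exists_threshold (fun x hx => hf x hx k) hw
  set M : ℝ := ∑ i, |e i| + 1 with hM
  have hM0 : 0 < M := by positivity
  refine feasible_of_forall_lt (fun i => if i = k then M * a' else a i)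
    (fun i => if i = k then M * b' else b i) (fun i => if i = k then M * c' else c i)
    (fun i j => if i = k then 0 else if j = k then e i else 0) (fun i => by aesop)
    fun x hx y hy hne => ?_
  have hsum : ∀ z : Fin m → ℝ, ∑ i, z i * ((if i = k then M * a' else a i) +
      (if i = k then M * b' else b i) * x 0 + (if i = k then M * c' else c i) * x 1 +
      ∑ j, (if i = k then 0 else if j = k then e i else 0) * z j) =
      M * (z k * (a' + b' * x 0 + c' * x 1)) +
        ∑ i ∈ univ.erase k, z i * (a i + b i * x 0 + c i * x 1 + e i * z k) := by
    intro z
    rw [← add_sum_erase _ _ (mem_univ k)]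
    congr 1
    · simp
      ring
    · refine sum_congr rfl fun i hi => ?_
      simp [ne_of_mem_erase hi]
  rw [hsum, hsum]
  by_cases hyk : y k = f x k
  · rw [hyk]
    simp only [hlin _ x hx]
    obtain ⟨j, hj⟩ := Function.ne_iff.mp hne
    refine add_lt_add_right (sum_spin_mul_lt (fun i _ => hy i) (fun i _ => hf x hx i)
      (fun i _ => by rw [spin_sq (hf x hx i)]; exact one_pos) ⟨j, ?_, hj⟩) _
    exact mem_erase.mpr ⟨fun h => hj (h ▸ hyk), mem_univ j⟩
  · have hyk' : y k = -f x k := by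
      rcases hy k with h | h <;> rcases hf x hx k with h' | h' <;> rw [h, h'] at hyk ⊢ <;>
        simp at hyk ⊢
    have hle : ∑ i ∈ univ.erase k, y i * (a i + b i * x 0 + c i * x 1 + e i * y k) ≤
        ∑ i ∈ univ.erase k, (f x i * (a i + b i * x 0 + c i * x 1 + e i * f x k) +
          2 * |e i|) := by
      refine sum_le_sum fun i _ => ?_
      have hi := hlin i x hx
      rw [hi, hyk', show a i + b i * x 0 + c i * x 1 + e i * -f x k = f x i - 2 * (e i * f x k) by
        linarith]
      have h1 := le_abs_self (e i)
      have h2 := neg_abs_le (e i)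
      rcases hy i with h | h <;> rcases hf x hx i with h' | h' <;>
        rcases hf x hx k with h'' | h'' <;> rw [h, h', h''] <;> linarith
    have hsub : ∑ i ∈ univ.erase k, 2 * |e i| ≤ 2 * (M - 1) := by
      rw [hM, add_sub_cancel_right, ← mul_sum]
      exact mul_le_mul_of_nonneg_left (sum_le_sum_of_subset_of_nonneg (erase_subset _ _)
        fun i _ _ => abs_nonneg _) zero_le_two
    rw [sum_add_distrib] at hle
    have hbig := mul_le_mul_of_nonneg_left (hthr x hx) hM0.le
    rw [hyk'] at hle ⊢
    rw [neg_mul, mul_neg]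
    linarith

lemma abs_walshTop_eq_two_of_spinAND {g : (Fin 2 → ℝ) → ℝ} {σ₀ σ₁ σ₂ : ℝ}
    (h₀ : σ₀ = -1 ∨ σ₀ = 1) (h₁ : σ₁ = -1 ∨ σ₁ = 1) (h₂ : σ₂ = -1 ∨ σ₂ = 1)
    (h : ∀ x, IsSpin x → g x = σ₀ * spinAND (σ₁ * x 0) (σ₂ * x 1)) :
    |walshTop g| = 2 := by
  rw [forall_isSpin_two] at h
  obtain ⟨hp, hq, hr, ht⟩ := h
  rw [walshTop, hp, hq, hr, ht]
  rcases h₀ with rfl | rfl <;> rcases h₁ with rfl | rfl <;> rcases h₂ with rfl | rfl <;>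
    norm_num [spinAND]

/-- A two-spin Boolean function which is not `AND` up to spin action is, up to sign, a character:
it is `±XOR` or orthogonal to `XOR`. -/
lemma walshTop_eq_zero_or_xor {g : (Fin 2 → ℝ) → ℝ} (hg : ∀ x, IsSpin x → g x = -1 ∨ g x = 1)
    (hand : ¬ ∃ σ₀ σ₁ σ₂ : ℝ, (σ₀ = -1 ∨ σ₀ = 1) ∧ (σ₁ = -1 ∨ σ₁ = 1) ∧ (σ₂ = -1 ∨ σ₂ = 1) ∧
      ∀ x, IsSpin x → g x = σ₀ * spinAND (σ₁ * x 0) (σ₂ * x 1)) :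
    walshTop g = 0 ∨ ∃ c : ℝ, ∀ x, IsSpin x → g x = c * (x 0 * x 1) := by
  rw [forall_isSpin_two] at hg
  by_contra hcon
  obtain ⟨hw, hx⟩ := not_or.mp hcon
  have hx₁ := fun h => hx ⟨1, forall_isSpin_two.mpr h⟩
  have hx₂ := fun h => hx ⟨-1, forall_isSpin_two.mpr h⟩
  refine hand ⟨-(g ![1, 1] + g ![1, -1] + g ![-1, 1] + g ![-1, -1]) / 2,
    -(g ![1, 1] + g ![1, -1] + g ![-1, 1] + g ![-1, -1]) / 2 *
      (g ![1, 1] + g ![1, -1] - g ![-1, 1] - g ![-1, -1]) / 2,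
    -(g ![1, 1] + g ![1, -1] + g ![-1, 1] + g ![-1, -1]) / 2 *
      (g ![1, 1] - g ![1, -1] + g ![-1, 1] - g ![-1, -1]) / 2, ?_⟩
  rw [forall_isSpin_two]
  rw [walshTop] at hw
  obtain ⟨hp, hq, hr, ht⟩ := hg
  rcases hp with hp | hp <;> rcases hq with hq | hq <;> rcases hr with hr | hr <;>
    rcases ht with ht | ht <;> simp [hp, hq, hr, ht] at hx₁ hx₂ <;>
    first
    | (refine absurd ?_ hw; norm_num [hp, hq, hr, ht]; done)
    | norm_num [hp, hq, hr, ht, spinAND]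

/-- The total Ising energy of a family of configurations depends only on the first and second
moments of the family. -/
lemma sum_isingH_congr {ι : Type*} [Fintype ι] {d : ℕ} (h : Fin d → ℝ)
    (J : Matrix (Fin d) (Fin d) ℝ) {s t : ι → Fin d → ℝ} (h₁ : ∀ i, ∑ p, s p i = ∑ p, t p i)
    (h₂ : ∀ i j, ∑ p, s p i * s p j = ∑ p, t p i * t p j) :
    ∑ p, isingH h J (s p) = ∑ p, isingH h J (t p) := by
  have key : ∀ u : ι → Fin d → ℝ, ∑ p, isingH h J (u p) =
      ∑ i, h i * ∑ p, u p i + ∑ i, ∑ j, if i < j then J i j * ∑ p, u p i * u p j else 0 := by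
    intro u
    simp only [isingH, sum_add_distrib]
    rw [sum_comm, sum_comm (t := univ (α := Fin d))]
    congr 1
    · simp only [mul_sum]
    · refine sum_congr rfl fun i _ => ?_
      rw [sum_comm]
      refine sum_congr rfl fun j _ => ?_
      split_ifs
      · simp only [mul_sum, mul_assoc]
      · simp
  simp only [key, h₁, h₂]

lemma sum_spinPoint (g : (Fin 2 → ℝ) → ℝ) :
    ∑ p, g (spinPoint p) = g ![1, 1] + g ![1, -1] + g ![-1, 1] + g ![-1, -1] := by
  simp [Fin.sum_univ_four, spinPoint]

lemma sum_mul_eq_zero_of_xor {g g' : (Fin 2 → ℝ) → ℝ} (hg : walshTop g = 0) {c : ℝ}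
    (hg' : ∀ x, IsSpin x → g' x = c * (x 0 * x 1)) :
    ∑ p, g (spinPoint p) * g' (spinPoint p) = 0 := by
  rw [sum_spinPoint (fun x => g x * g' x)]
  rw [forall_isSpin_two] at hg'
  obtain ⟨hp, hq, hr, ht⟩ := hg'
  rw [walshTop] at hg
  simp only [hp, hq, hr, ht]
  simp
  linear_combination c * hg

lemma not_feasible_of_xor {m : ℕ} {f : (Fin 2 → ℝ) → Fin m → ℝ}
    (hf : ∀ x, IsSpin x → IsSpin (f x))
    (hall : ∀ i, walshTop (fun x => f x i) = 0 ∨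
      ∃ c : ℝ, ∀ x, IsSpin x → f x i = c * (x 0 * x 1))
    (k : Fin m) (hk : ∃ c : ℝ, ∀ x, IsSpin x → f x k = c * (x 0 * x 1)) :
    ¬ Feasible 2 m f := by
  classical
  rintro ⟨h, J, -, henc⟩
  let IsXor : Fin (2 + m) → Prop := fun j =>
    ∃ c : ℝ, ∀ x, IsSpin x → Fin.append x (f x) j = c * (x 0 * x 1)
  let ε : Fin (2 + m) → ℝ := fun j => if IsXor j then -1 else 1
  have hdich : ∀ j, ¬ IsXor j → walshTop (fun x => Fin.append x (f x) j) = 0 := by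
    intro j
    refine Fin.addCases (fun i _ => ?_) (fun i hi => ?_) j
    · simp only [walshTop, Fin.append_left]
      fin_cases i <;> simp
    · simp only [IsXor, Fin.append_right] at hi ⊢
      exact (hall i).resolve_right hi
  have hin : ∀ i : Fin 2, ε (Fin.castAdd m i) = 1 := by
    intro i
    refine if_neg ?_
    rintro ⟨c, hc⟩
    simp only [Fin.append_left] at hc
    rw [forall_isSpin_two] at hc
    obtain ⟨hp, hq, hr, ht⟩ := hc
    fin_cases i <;> simp at hp hq hr ht <;> linarith
  let y : Fin 4 → Fin m → ℝ := fun p i => ε (Fin.natAdd 2 i) * f (spinPoint p) i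
  have happ : ∀ p j, Fin.append (spinPoint p) (y p) j =
      ε j * Fin.append (spinPoint p) (f (spinPoint p)) j := by
    intro p j
    refine Fin.addCases (fun i => ?_) (fun i => ?_) j
    · simp [hin]
    · simp [y]
  have hlt : ∀ p, isingH h J (Fin.append (spinPoint p) (f (spinPoint p))) <
      isingH h J (Fin.append (spinPoint p) (y p)) := by
    intro p
    have hs := isSpin_spinPoint p
    refine henc _ hs _ (fun i => ?_) fun heq => ?_
    · simp only [y, ε]
      rcases hf _ hs i with h | h <;> split_ifs <;> simp [h]
    · have hε : ε (Fin.natAdd 2 k) = -1 := if_pos (by simpa [IsXor] using hk)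
      have := congrFun heq k
      simp only [y, hε] at this
      rcases hf _ hs k with h | h <;> rw [h] at this <;> norm_num at this
  refine (sum_lt_sum_of_nonempty univ_nonempty fun p _ => hlt p).ne
    (sum_isingH_congr h J (fun i => ?_) fun i j => ?_)
  · simp only [happ, ← mul_sum]
    by_cases hi : IsXor i
    · obtain ⟨c, hc⟩ := hi
      have := sum_mul_eq_zero_of_xor (g := fun _ => 1) (by simp [walshTop]) hc
      simp only [one_mul] at this
      simp [this]
    · simp [ε, hi]
  · have hmul : ∀ p, Fin.append (spinPoint p) (y p) i * Fin.append (spinPoint p) (y p) j =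
        (ε i * ε j) * (Fin.append (spinPoint p) (f (spinPoint p)) i *
          Fin.append (spinPoint p) (f (spinPoint p)) j) := by
      intro p
      rw [happ, happ]
      ring
    simp only [hmul, ← mul_sum]
    by_cases hi : IsXor i <;> by_cases hj : IsXor j
    · simp [ε, hi, hj]
    · have := sum_mul_eq_zero_of_xor (hdich j hj) hi.choose_spec
      simp only [mul_comm (Fin.append _ _ j)] at this
      simp [this]
    · have := sum_mul_eq_zero_of_xor (hdich i hi) hj.choose_spec
      simp [this]
    · simp [ε, hi, hj]

/-- a circuit `(2,m,f)` is feasible iff (1) no component of `f` is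
`XOR` or `−XOR`, or (2) some component of `f` is `AND` up to spin action. -/
theorem statement17 (m : ℕ) (f : (Fin 2 → ℝ) → (Fin m → ℝ))
    (hf : ∀ x, IsSpin x → IsSpin (f x)) :
    Feasible 2 m f ↔
      ((∀ i : Fin m,
          ¬ (∀ x, IsSpin x → f x i = -(x 0 * x 1)) ∧
          ¬ (∀ x, IsSpin x → f x i = x 0 * x 1)) ∨
       (∃ (i : Fin m) (σ₀ σ₁ σ₂ : ℝ),
          (σ₀ = -1 ∨ σ₀ = 1) ∧ (σ₁ = -1 ∨ σ₁ = 1) ∧ (σ₂ = -1 ∨ σ₂ = 1) ∧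
          ∀ x, IsSpin x → f x i = σ₀ * spinAND (σ₁ * x 0) (σ₂ * x 1))) := by
  constructor
  · intro hfeas
    by_contra hcon
    obtain ⟨hxor, hand⟩ := not_or.mp hcon
    have hall : ∀ i, walshTop (fun x => f x i) = 0 ∨
        ∃ c : ℝ, ∀ x, IsSpin x → f x i = c * (x 0 * x 1) := fun i =>
      walshTop_eq_zero_or_xor (fun x hx => hf x hx i) fun h => hand ⟨i, h⟩
    refine hxor fun k => ⟨fun hk => ?_, fun hk => ?_⟩
    · exact not_feasible_of_xor hf hall k ⟨-1, fun x hx => by rw [hk x hx]; ring⟩ hfeas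
    · exact not_feasible_of_xor hf hall k ⟨1, fun x hx => by rw [hk x hx]; ring⟩ hfeas
  · rintro (hxor | ⟨k, σ₀, σ₁, σ₂, h₀, h₁, h₂, hk⟩)
    · exact feasible_of_forall_abs_walshTop_le hf fun i =>
        abs_walshTop_le_two (fun x hx => hf x hx i) (hxor i).1 (hxor i).2
    · have hw := abs_walshTop_eq_two_of_spinAND h₀ h₁ h₂ hk
      refine feasible_of_walshTop_ne_zero hf k (fun h => ?_) hw.le
      rw [h] at hw
      norm_num at hw
end
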